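/- Let U ⊆ ℝ² be a nonempty open convex set with coordinates (t,s), and let u, v : U → ℝ³ be C¹ maps whose component pairs (u_j, v_j), j = 1,2,3, are split-holomorphic (∂u_j/∂t = ∂v_j/∂s, ∂u_j/∂s = ∂v_j/∂t). Assume on U: (i) −(u₁² + v₁²) + (u₂² + v₂²) + (u₃² + v₃²) = 0 and −u₁v₁ + u₂v₂ + u₃v₃ = 0 (i.e. −φ₁² + φ₂² + φ₃² = 0 for φ_j = u_j + k'v_j); and (ii) (u₁² − v₁²) − (u₂² − v₂²) − (u₃² − v₃²) > 0 (i.e. −|φ₁|² + |φ₂|² + |φ₃|² > 0, with |a + k'b|² = b² − a²). Then there exists a C² map X : U → ℝ³ with ∂X/∂t = 2u and ∂X/∂s = 2v, and every such X is a conformal timelike minimal immersion; moreover X_t and X_s are linearly independent at every point of U. -/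

import Mathlib

/-- Partial derivative in the first (t) coordinate. -/
noncomputable def pdt {E : Type*} [NormedAddCommGroup E] [NormedSpace ℝ E]
    (f : ℝ × ℝ → E) (p : ℝ × ℝ) : E := deriv (fun x => f (x, p.2)) p.1

/-- Partial derivative in the second (s) coordinate. -/
noncomputable def pds {E : Type*} [NormedAddCommGroup E] [NormedSpace ℝ E]
    (f : ℝ × ℝ → E) (p : ℝ × ℝ) : E := deriv (fun y => f (p.1, y)) p.2

/-- The Minkowski inner product on ℝ³ = ℝ × ℝ × ℝ: ⟨x,y⟩ = -x₁y₁ + x₂y₂ + x₃y₃. -/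
def mink (x y : ℝ × ℝ × ℝ) : ℝ := -(x.1 * y.1) + x.2.1 * y.2.1 + x.2.2 * y.2.2

/-- The Lorentzian cross product on ℝ³, characterized by ⟨u ×ₗ v, w⟩ = det[u,v,w]. -/
def lcross (u v : ℝ × ℝ × ℝ) : ℝ × ℝ × ℝ :=
  (-(u.2.1 * v.2.2 - u.2.2 * v.2.1), u.2.2 * v.1 - u.1 * v.2.2, u.1 * v.2.1 - u.2.1 * v.1)

section PartialDerivatives

variable {E : Type*} [NormedAddCommGroup E] [NormedSpace ℝ E]

theorem HasFDerivAt.pdt_eq {f : ℝ × ℝ → E} {f' : ℝ × ℝ →L[ℝ] E} {p : ℝ × ℝ}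
    (h : HasFDerivAt f f' p) : pdt f p = f' (1, 0) :=
  (HasFDerivAt.comp_hasDerivAt (f := fun x : ℝ => (x, p.2)) p.1 h
    ((hasDerivAt_id p.1).prodMk (hasDerivAt_const p.1 p.2))).deriv

theorem HasFDerivAt.pds_eq {f : ℝ × ℝ → E} {f' : ℝ × ℝ →L[ℝ] E} {p : ℝ × ℝ}
    (h : HasFDerivAt f f' p) : pds f p = f' (0, 1) :=
  (HasFDerivAt.comp_hasDerivAt (f := fun y : ℝ => (p.1, y)) p.2 h
    ((hasDerivAt_const p.2 p.1).prodMk (hasDerivAt_id p.2))).deriv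

theorem DifferentiableAt.fderiv_apply_eq_pdt_pds {f : ℝ × ℝ → E} {p : ℝ × ℝ}
    (h : DifferentiableAt ℝ f p) (x : ℝ × ℝ) :
    fderiv ℝ f p x = x.1 • pdt f p + x.2 • pds f p := by
  rw [h.hasFDerivAt.pdt_eq, h.hasFDerivAt.pds_eq, ← map_smul, ← map_smul, ← map_add]
  simp

theorem pdt_congr_of_isOpen {U : Set (ℝ × ℝ)} (hU : IsOpen U) {f g : ℝ × ℝ → E}
    (hfg : ∀ q ∈ U, f q = g q) {p : ℝ × ℝ} (hp : p ∈ U) : pdt f p = pdt g p := by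
  apply Filter.EventuallyEq.deriv_eq
  have hc : Continuous fun x : ℝ => (x, p.2) := by fun_prop
  filter_upwards [hc.continuousAt.preimage_mem_nhds (hU.mem_nhds hp)] with x hx
  exact hfg _ hx

theorem pds_congr_of_isOpen {U : Set (ℝ × ℝ)} (hU : IsOpen U) {f g : ℝ × ℝ → E}
    (hfg : ∀ q ∈ U, f q = g q) {p : ℝ × ℝ} (hp : p ∈ U) : pds f p = pds g p := by
  apply Filter.EventuallyEq.deriv_eq
  have hc : Continuous fun y : ℝ => (p.1, y) := by fun_prop
  filter_upwards [hc.continuousAt.preimage_mem_nhds (hU.mem_nhds hp)] with y hy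
  exact hfg _ hy

theorem pdt_const_smul {f : ℝ × ℝ → E} (c : ℝ) (p : ℝ × ℝ) :
    pdt (fun q => c • f q) p = c • pdt f p :=
  deriv_fun_const_smul_field c _

theorem pds_const_smul {f : ℝ × ℝ → E} (c : ℝ) (p : ℝ × ℝ) :
    pds (fun q => c • f q) p = c • pds f p :=
  deriv_fun_const_smul_field c _

/-- On a convex open set, `C¹` data `a`, `b` with `∂a/∂s = ∂b/∂t` are the partial derivatives
of a `C²` map. -/
theorem exists_contDiffOn_two_pdt_eq_pds_eq {U : Set (ℝ × ℝ)} (hU : IsOpen U)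
    (hconv : Convex ℝ U) [CompleteSpace E] {a b : ℝ × ℝ → E} (ha : ContDiffOn ℝ 1 a U)
    (hb : ContDiffOn ℝ 1 b U) (hab : ∀ p ∈ U, pds a p = pdt b p) :
    ∃ X : ℝ × ℝ → E, ContDiffOn ℝ 2 X U ∧ ∀ p ∈ U, pdt X p = a p ∧ pds X p = b p := by
  let L₁ := ContinuousLinearMap.smulRightL ℝ (ℝ × ℝ) E (ContinuousLinearMap.fst ℝ ℝ ℝ)
  let L₂ := ContinuousLinearMap.smulRightL ℝ (ℝ × ℝ) E (ContinuousLinearMap.snd ℝ ℝ ℝ)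
  have hL₁ : ∀ (e : E) (x : ℝ × ℝ), L₁ e x = x.1 • e := fun _ _ => rfl
  have hL₂ : ∀ (e : E) (x : ℝ × ℝ), L₂ e x = x.2 • e := fun _ _ => rfl
  let ω : ℝ × ℝ → ℝ × ℝ →L[ℝ] E := fun p => L₁ (a p) + L₂ (b p)
  have hω : ContDiffOn ℝ 1 ω U :=
    (L₁.contDiff.comp_contDiffOn ha).add (L₂.contDiff.comp_contDiffOn hb)
  have hclosed : ∀ p ∈ U, ∀ x y, fderiv ℝ ω p x y = fderiv ℝ ω p y x := by
    intro p hp x y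
    have hpa := (ha.differentiableOn one_ne_zero).differentiableAt (hU.mem_nhds hp)
    have hpb := (hb.differentiableOn one_ne_zero).differentiableAt (hU.mem_nhds hp)
    have hd : HasFDerivAt ω (L₁ ∘L fderiv ℝ a p + L₂ ∘L fderiv ℝ b p) p :=
      (L₁.hasFDerivAt.comp p hpa.hasFDerivAt).add (L₂.hasFDerivAt.comp p hpb.hasFDerivAt)
    rw [hd.fderiv]
    simp only [add_apply, ContinuousLinearMap.comp_apply, hL₁, hL₂,
      hpa.fderiv_apply_eq_pdt_pds, hpb.fderiv_apply_eq_pdt_pds, hab p hp]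
    module
  obtain ⟨X, hX⟩ := hconv.exists_forall_hasFDerivAt_of_fderiv_symmetric hU
    (hω.differentiableOn one_ne_zero) hclosed
  refine ⟨X, ?_, fun p hp => ?_⟩
  · rw [← one_add_one_eq_two, contDiffOn_succ_iff_hasFDerivWithinAt_of_uniqueDiffOn
      hU.uniqueDiffOn]
    exact ⟨by simp, ω, hω, fun x hx => (hX x hx).hasFDerivWithinAt⟩
  · rw [(hX p hp).pdt_eq, (hX p hp).pds_eq]
    simp [ω, hL₁, hL₂]

end PartialDerivatives

theorem mink_smul_smul (c d : ℝ) (x y : ℝ × ℝ × ℝ) :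
    mink (c • x) (d • y) = c * d * mink x y := by
  simp only [mink, Prod.smul_fst, Prod.smul_snd, smul_eq_mul]
  ring

theorem linearIndependent_pair_of_mink_eq_zero {x y : ℝ × ℝ × ℝ} (hxy : mink x y = 0)
    (hx : mink x x ≠ 0) (hy : mink y y ≠ 0) : LinearIndependent ℝ ![x, y] := by
  rw [LinearIndependent.pair_iff]
  intro c d h
  have h₁ : mink x (c • x + d • y) = c * mink x x + d * mink x y := by
    simp only [mink, Prod.smul_fst, Prod.smul_snd, Prod.fst_add, Prod.snd_add, smul_eq_mul]
    ring
  have h₂ : mink y (c • x + d • y) = c * mink x y + d * mink y y := by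
    simp only [mink, Prod.smul_fst, Prod.smul_snd, Prod.fst_add, Prod.snd_add, smul_eq_mul]
    ring
  have h₀ : ∀ z, mink z 0 = 0 := fun z => by simp [mink]
  rw [h, h₀, hxy] at h₁ h₂
  constructor
  · simpa [hx] using h₁.symm
  · simpa [hy] using h₂.symm

/-- Weierstrass-type representation: split-holomorphic data φ = (u,v) : U → ℂ'³ on a
nonempty open convex set, with −φ₁² + φ₂² + φ₃² = 0 and −|φ₁|² + |φ₂|² + |φ₃|² > 0,
integrates to a conformal timelike minimal immersion X with X_t = 2u, X_s = 2v. -/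
theorem stmt8 (U : Set (ℝ × ℝ)) (hU : IsOpen U) (hconv : Convex ℝ U) (hne : U.Nonempty)
    (u v : ℝ × ℝ → ℝ × ℝ × ℝ) (hu : ContDiffOn ℝ 1 u U) (hv : ContDiffOn ℝ 1 v U)
    (hCR1 : ∀ p ∈ U, pdt u p = pds v p) (hCR2 : ∀ p ∈ U, pds u p = pdt v p)
    (hzero1 : ∀ p ∈ U,
      -(((u p).1) ^ 2 + ((v p).1) ^ 2) + (((u p).2.1) ^ 2 + ((v p).2.1) ^ 2)
        + (((u p).2.2) ^ 2 + ((v p).2.2) ^ 2) = 0)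
    (hzero2 : ∀ p ∈ U,
      -((u p).1 * (v p).1) + (u p).2.1 * (v p).2.1 + (u p).2.2 * (v p).2.2 = 0)
    (hpos : ∀ p ∈ U,
      0 < (((u p).1) ^ 2 - ((v p).1) ^ 2) - (((u p).2.1) ^ 2 - ((v p).2.1) ^ 2)
        - (((u p).2.2) ^ 2 - ((v p).2.2) ^ 2)) :
    (∃ X : ℝ × ℝ → ℝ × ℝ × ℝ, ContDiffOn ℝ 2 X U ∧
      ∀ p ∈ U, pdt X p = (2 : ℝ) • u p ∧ pds X p = (2 : ℝ) • v p) ∧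
    (∀ X : ℝ × ℝ → ℝ × ℝ × ℝ, ContDiffOn ℝ 2 X U →
      (∀ p ∈ U, pdt X p = (2 : ℝ) • u p ∧ pds X p = (2 : ℝ) • v p) →
      ∀ p ∈ U,
        mink (pdt X p) (pdt X p) + mink (pds X p) (pds X p) = 0 ∧
        mink (pdt X p) (pds X p) = 0 ∧
        mink (pdt X p) (pdt X p) < 0 ∧
        pdt (pdt X) p = pds (pds X) p ∧
        LinearIndependent ℝ ![pdt X p, pds X p]) := by
  refine ⟨?_, fun X _ hXd p hp => ?_⟩
  · refine exists_contDiffOn_two_pdt_eq_pds_eq hU hconv (hu.const_smul (2 : ℝ))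
      (hv.const_smul (2 : ℝ)) fun p hp => ?_
    rw [pds_const_smul, pdt_const_smul, hCR2 p hp]
  · have h₁ : mink (u p) (u p) + mink (v p) (v p) = 0 := by
      rw [← hzero1 p hp]
      simp only [mink]
      ring
    have h₂ : mink (u p) (v p) = 0 := hzero2 p hp
    have h₃ : mink (u p) (u p) < mink (v p) (v p) := by
      have := hpos p hp
      simp only [mink]
      linarith
    have hwave : pdt (pdt X) p = pds (pds X) p := by
      rw [pdt_congr_of_isOpen hU (fun q hq => (hXd q hq).1) hp,
        pds_congr_of_isOpen hU (fun q hq => (hXd q hq).2) hp,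
        pdt_const_smul, pds_const_smul, hCR1 p hp]
    rw [hwave, (hXd p hp).1, (hXd p hp).2]
    simp only [mink_smul_smul]
    refine ⟨by linarith, by rw [h₂, mul_zero], by linarith, trivial,
      linearIndependent_pair_of_mink_eq_zero ?_ ?_ ?_⟩ <;> rw [mink_smul_smul]
    · rw [h₂, mul_zero]
    · exact (by linarith : 2 * 2 * mink (u p) (u p) < 0).ne
    · exact (by linarith : 0 < 2 * 2 * mink (v p) (v p)).ne'
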